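/- Let m and k be positive integers with m > k, and let A ∈ 𝒜_k. Then a subset Λ of the nonnegative integers is a numerical semigroup with multiplicity m and type (A; k) if and only if Λ is of the form (written as a disjoint union) Λ = {0} ∪ (m + A) ∪ (2m + (A + A) ∩ [0, k]) ∪ B ∪ [2m + k + 1, ∞), where B is some subset of [m+k+1, 2m+k−1] \ (2m + A + A). -/

import Mathlib

open Pointwise

/-- A numerical semigroup: a set of nonnegative integers containing `0`,
closed under addition, with finite complement in `ℕ`. -/
def IsNumericalSemigroup (Λ : Set ℕ) : Prop :=
  0 ∈ Λ ∧ (∀ a ∈ Λ, ∀ b ∈ Λ, a + b ∈ Λ) ∧ (Λᶜ).Finite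

/-- The multiplicity `m(Λ)`: the smallest nonzero element of `Λ`. -/
noncomputable def mult (Λ : Set ℕ) : ℕ := sInf {n | n ∈ Λ ∧ n ≠ 0}

/-- The Frobenius number `f(Λ)`: the largest nonnegative integer not in `Λ`. -/
noncomputable def frob (Λ : Set ℕ) : ℕ := sSup Λᶜ

/-- The genus `g(Λ)`: the number of nonnegative integers not in `Λ`. -/
noncomputable def genus (Λ : Set ℕ) : ℕ := Λᶜ.ncard

/-- Fibonacci numbers indexed by `ℤ`, with `F_n = 0` for `n ≤ 0`,
`F_1 = F_2 = 1`, `F_{n+2} = F_{n+1} + F_n`. -/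
def fibZ (n : ℤ) : ℕ := if 0 < n then Nat.fib n.toNat else 0

/-- Binomial coefficient `C(a, b)` for integers, interpreted as `0` unless `0 ≤ b ≤ a`. -/
def chooseZ (a b : ℤ) : ℕ := if 0 ≤ b ∧ b ≤ a then a.toNat.choose b.toNat else 0

/-- `𝒜_k`: the collection of subsets `A ⊆ [0, k-1]` with `0 ∈ A` and `k ∉ A + A`. -/
def AkSet (k : ℕ) : Finset (Finset ℕ) :=
  (Finset.range k).powerset.filter (fun A => 0 ∈ A ∧ k ∉ A + A)

/-- A numerical semigroup `Λ` (with multiplicity `m = m(Λ)`) has type `(A; k)` if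
`f(Λ) = 2m + k` and `Λ ∩ [m, m+k] = A + m`. -/
noncomputable def HasType (Λ : Set ℕ) (k : ℕ) (A : Finset ℕ) : Prop :=
  frob Λ = 2 * mult Λ + k ∧
    Λ ∩ Set.Icc (mult Λ) (mult Λ + k) = (fun a => a + mult Λ) '' (A : Set ℕ)

/-- `t_g`: the number of numerical semigroups of genus `g` with `f < 3m`. -/
noncomputable def tCount (g : ℕ) : ℕ :=
  {Λ : Set ℕ | IsNumericalSemigroup Λ ∧ genus Λ = g ∧ frob Λ < 3 * mult Λ}.ncard

/-- `n_g`: the number of numerical semigroups of genus `g`. -/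
noncomputable def nCount (g : ℕ) : ℕ :=
  {Λ : Set ℕ | IsNumericalSemigroup Λ ∧ genus Λ = g}.ncard

theorem mult_eq_of_isLeast {Λ : Set ℕ} {m : ℕ} (h : IsLeast {n | n ∈ Λ ∧ n ≠ 0} m) :
    mult Λ = m :=
  h.csInf_eq

theorem frob_eq_of_isGreatest {Λ : Set ℕ} {f : ℕ} (h : IsGreatest Λᶜ f) : frob Λ = f :=
  h.csSup_eq

theorem IsNumericalSemigroup.le_frob {Λ : Set ℕ} (h : IsNumericalSemigroup Λ) {n : ℕ}
    (hn : n ∉ Λ) : n ≤ frob Λ :=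
  le_csSup h.2.2.bddAbove hn

theorem IsNumericalSemigroup.frob_notMem {Λ : Set ℕ} (h : IsNumericalSemigroup Λ)
    (hf : 0 < frob Λ) : frob Λ ∉ Λ := by
  have hne : Λᶜ.Nonempty := by
    rw [Set.nonempty_iff_ne_empty]
    intro he
    simp [frob, he] at hf
  exact Nat.sSup_mem hne h.2.2.bddAbove

theorem mult_le_of_mem {Λ : Set ℕ} {n : ℕ} (hn : n ∈ Λ) (h0 : n ≠ 0) : mult Λ ≤ n :=
  Nat.sInf_le ⟨hn, h0⟩

theorem mem_AkSet {k : ℕ} {A : Finset ℕ} :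
    A ∈ AkSet k ↔ (∀ a ∈ A, a < k) ∧ 0 ∈ A ∧ k ∉ A + A := by
  simp [AkSet, Finset.subset_iff]

/-- For positive integers `m > k` and `A ∈ 𝒜_k`, a set `Λ ⊆ ℕ` is a
numerical semigroup with multiplicity `m` and type `(A; k)` iff
`Λ = {0} ∪ (m + A) ∪ (2m + (A+A) ∩ [0,k]) ∪ B ∪ [2m+k+1, ∞)` for some
`B ⊆ [m+k+1, 2m+k-1] \ (2m + A + A)`. -/
theorem statement5 (m k : ℕ) (hk : 0 < k) (hmk : k < m) (A : Finset ℕ)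
    (hA : A ∈ AkSet k) (Λ : Set ℕ) :
    (IsNumericalSemigroup Λ ∧ mult Λ = m ∧ HasType Λ k A) ↔
      ∃ B : Set ℕ,
        B ⊆ Set.Icc (m + k + 1) (2 * m + k - 1) \ ((fun x => x + 2 * m) '' ((A + A : Finset ℕ) : Set ℕ)) ∧
        Λ = {0} ∪ ((fun a => a + m) '' (A : Set ℕ)) ∪
            ((fun x => x + 2 * m) '' (((A + A).filter (fun x => x ≤ k) : Finset ℕ) : Set ℕ)) ∪
            B ∪ Set.Ici (2 * m + k + 1) := by
  obtain ⟨hlt, h0A, hkA⟩ := mem_AkSet.1 hA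
  constructor
  · rintro ⟨hS, rfl, hf, hI⟩
    set m := mult Λ with hm
    have hAmem : ∀ a ∈ A, a + m ∈ Λ := fun a ha =>
      (hI.symm.subset (Set.mem_image_of_mem _ ha)).1
    have hAA : ∀ x ∈ A + A, x + 2 * m ∈ Λ := by
      intro x hx
      obtain ⟨a, ha, b, hb, rfl⟩ := Finset.mem_add.1 hx
      have := hS.2.1 _ (hAmem a ha) _ (hAmem b hb)
      rwa [show a + b + 2 * m = a + m + (b + m) by ring]
    have hfn : 2 * m + k ∉ Λ := hf ▸ hS.frob_notMem (by omega)
    refine ⟨(Λ ∩ Set.Icc (m + k + 1) (2 * m + k - 1)) \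
      ((fun x => x + 2 * m) '' ((A + A : Finset ℕ) : Set ℕ)),
      Set.sdiff_subset_sdiff_left Set.inter_subset_right, ?_⟩
    ext n
    constructor
    · intro hn
      by_cases h0 : n = 0
      · simp [h0]
      have hmn : m ≤ n := mult_le_of_mem hn h0
      by_cases h1 : n ≤ m + k
      · exact .inl (.inl (.inl (.inr (hI.subset ⟨hn, hmn, h1⟩))))
      by_cases h2 : 2 * m + k + 1 ≤ n
      · exact .inr h2
      have h3 : n ≠ 2 * m + k := fun h => hfn (h ▸ hn)
      by_cases h4 : n ∈ (fun x => x + 2 * m) '' ((A + A : Finset ℕ) : Set ℕ)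
      · obtain ⟨x, hx, rfl⟩ := h4
        refine .inl (.inl (.inr ⟨x, ?_, rfl⟩))
        exact Finset.mem_coe.2 (Finset.mem_filter.2 ⟨hx, by dsimp only at h2; omega⟩)
      · exact .inl (.inr ⟨⟨hn, by omega, by omega⟩, h4⟩)
    · rintro ((((rfl | ⟨a, ha, rfl⟩) | ⟨x, hx, rfl⟩) | hB) | hn)
      · exact hS.1
      · exact hAmem a ha
      · exact hAA x (Finset.mem_filter.1 hx).1
      · exact hB.1.1
      · by_contra hc
        have := hS.le_frob hc
        have := Set.mem_Ici.1 hn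
        omega
  · rintro ⟨B, hB, hΛ⟩
    have hmem : ∀ n, n ∈ Λ ↔ n = 0 ∨ (∃ a ∈ A, a + m = n) ∨
        (∃ x ∈ A + A, x ≤ k ∧ x + 2 * m = n) ∨ n ∈ B ∨ 2 * m + k + 1 ≤ n := by
      intro n
      simp only [hΛ, Set.mem_union, Set.mem_singleton_iff, Set.mem_image, Finset.mem_coe,
        Finset.mem_filter, Set.mem_Ici, and_assoc, or_assoc]
    clear hΛ
    have hBb : ∀ n ∈ B, m + k + 1 ≤ n ∧ n ≤ 2 * m + k - 1 := fun n hn => (hB hn).1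
    have hge : ∀ n ∈ Λ, n ≠ 0 → m ≤ n := by
      intro n hn h0
      rcases (hmem n).1 hn with h | ⟨a, _, rfl⟩ | ⟨x, _, _, rfl⟩ | h | h
      · exact absurd h h0
      · omega
      · omega
      · have := hBb n h; omega
      · omega
    have hlow : ∀ n ∈ Λ, n ≠ 0 → n ≤ m + k → ∃ a ∈ A, a + m = n := by
      intro n hn h0 hle
      rcases (hmem n).1 hn with h | h | ⟨x, _, _, rfl⟩ | h | h
      · exact absurd h h0
      · exact h
      · omega
      · have := hBb n h; omega
      · omega
    have hmul : mult Λ = m := mult_eq_of_isLeast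
      ⟨⟨(hmem m).2 (.inr (.inl ⟨0, h0A, by simp⟩)), by omega⟩, fun n hn => hge n hn.1 hn.2⟩
    have hub : ∀ n ∈ Λᶜ, n ≤ 2 * m + k := by
      intro n hn
      by_contra hc
      exact hn ((hmem n).2 (.inr (.inr (.inr (.inr (by omega))))))
    have hfn : 2 * m + k ∉ Λ := by
      intro hn
      rcases (hmem _).1 hn with h | ⟨a, ha, h⟩ | ⟨x, hx, _, h⟩ | h | h
      · omega
      · have := hlt a ha; omega
      · exact hkA ((show x = k by omega) ▸ hx)
      · have := hBb _ h; omega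
      · omega
    refine ⟨⟨(hmem 0).2 (.inl rfl), ?_, (Set.finite_Iic (2 * m + k)).subset hub⟩, hmul, ?_, ?_⟩
    · intro a ha b hb
      by_cases ha0 : a = 0
      · simpa [ha0] using hb
      by_cases hb0 : b = 0
      · simpa [hb0] using ha
      have h1 := hge a ha ha0
      have h2 := hge b hb hb0
      by_cases hs : 2 * m + k + 1 ≤ a + b
      · exact (hmem _).2 (.inr (.inr (.inr (.inr hs))))
      obtain ⟨x, hx, rfl⟩ := hlow a ha ha0 (by omega)
      obtain ⟨y, hy, rfl⟩ := hlow b hb hb0 (by omega)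
      exact (hmem _).2 (.inr (.inr (.inl
        ⟨x + y, Finset.add_mem_add hx hy, by omega, by omega⟩)))
    · rw [hmul]
      exact frob_eq_of_isGreatest ⟨hfn, hub⟩
    · rw [hmul]
      ext n
      constructor
      · rintro ⟨hn, h1, h2⟩
        exact hlow n hn (by omega) h2
      · rintro ⟨a, ha, rfl⟩
        have := hlt a ha
        exact ⟨(hmem _).2 (.inr (.inl ⟨a, ha, rfl⟩)), Nat.le_add_left _ _, by dsimp only; omega⟩
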